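/- There exist universal constants n₀ ∈ ℕ and c' > 0 with the following property. Let n ≥ n₀, let B be a smooth origin-symmetric convex body in ℝⁿ in the ℓ-position such that the standard basis of ℝⁿ is 1-unconditional with respect to ‖·‖_B, and let i ≤ n, p ≥ 1 and τ > 0 be such that E(‖G‖_B^{2p−2}·Fᵢ²(B,G)) ≤ n^{−τ} · E(‖G‖_B^{2p−2}·⟨grad_B(G), eᵢ⟩²). Then (E|‖G‖_B^{p−1}·⟨grad_B(G), eᵢ⟩|)² ≤ 2(n^{−c'} + n^{−τ}) · E(‖G‖_B^{2p−2}·⟨grad_B(G), eᵢ⟩²). -/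

import Mathlib

open MeasureTheory ProbabilityTheory Real
open scoped ENNReal RealInnerProductSpace

noncomputable section

/-- `ℝⁿ` with the Euclidean structure. -/
abbrev Euc (n : ℕ) := EuclideanSpace ℝ (Fin n)

/-- An origin-symmetric convex body in `ℝⁿ`: a compact convex set, symmetric about the
origin, with `0` in its interior. -/
def IsSymmConvexBody {n : ℕ} (B : Set (Euc n)) : Prop :=
  IsCompact B ∧ Convex ℝ B ∧ (0 : Euc n) ∈ interior B ∧ ∀ x ∈ B, -x ∈ B

/-- The standard Gaussian measure `γₙ` on `ℝⁿ`. -/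
def stdGaussian (n : ℕ) : Measure (Euc n) :=
  (Measure.pi fun _ : Fin n => gaussianReal 0 1).map
    ((EuclideanSpace.equiv (Fin n) ℝ).symm)

/-- `B` is in the ℓ-position: `ℓ(B, Id) = 1` (i.e. `E‖G‖_B² = 1`, where `‖·‖_B = gauge B`
is the Minkowski functional) and every linear operator `U` with `ℓ(B,U) ≤ 1` has
`|det U| ≤ 1`; together these say `sup{|det U| : ℓ(B,U) ≤ 1} = 1 = det Id`. -/
def IsEllPosition {n : ℕ} (B : Set (Euc n)) : Prop :=
  (∫ x, gauge B x ^ 2 ∂stdGaussian n) = 1 ∧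
  ∀ U : Euc n →ₗ[ℝ] Euc n,
    (∫ x, gauge B (U x) ^ 2 ∂stdGaussian n) ≤ 1 → |LinearMap.det U| ≤ 1

/-- The standard basis of `ℝⁿ` is `1`-unconditional for `‖·‖_B`. -/
def StdUncond {n : ℕ} (B : Set (Euc n)) : Prop :=
  ∀ (x σ : Fin n → ℝ), (∀ i, σ i = 1 ∨ σ i = -1) →
    gauge B ((EuclideanSpace.equiv (Fin n) ℝ).symm fun i => σ i * x i) =
      gauge B ((EuclideanSpace.equiv (Fin n) ℝ).symm x)

/-- The 'flat part' of the `i`-th coordinate of the gradient: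
`Fᵢ(B,x) = ⟨grad_B(x), eᵢ⟩·1{|⟨grad_B(x), eᵢ⟩| ≤ n^{−1/8}·E‖G‖_B}`. -/
def flatPart {n : ℕ} (B : Set (Euc n)) (gradB : Euc n → Euc n) (i : Fin n) (x : Euc n) : ℝ :=
  if |gradB x i| ≤ (n : ℝ) ^ (-(1 : ℝ) / 8) * ∫ y, gauge B y ∂stdGaussian n then
    gradB x i
  else 0

/-- Cauchy–Schwarz for the integral of a function over a set. -/
lemma setIntegral_abs_sq_le {Ω : Type*} [MeasurableSpace Ω] {μ : Measure Ω} [IsFiniteMeasure μ]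
    {ψ : Ω → ℝ} (hψ : MemLp ψ 2 μ) (A : Set Ω) :
    (∫ x in A, |ψ x| ∂μ) ^ 2 ≤ μ.real A * ∫ x in A, ψ x ^ 2 ∂μ := by
  have hsq : Integrable (fun x => ψ x ^ 2) (μ.restrict A) := hψ.integrable_sq.restrict
  have habs : Integrable (fun x => |ψ x|) (μ.restrict A) :=
    (hψ.integrable one_le_two).abs.restrict
  have key : ∀ t : ℝ, 0 ≤ μ.real A * (t * t) + (-2 * ∫ x in A, |ψ x| ∂μ) * t
      + ∫ x in A, ψ x ^ 2 ∂μ := by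
    intro t
    have h : ∫ x in A, (|ψ x| - t) ^ 2 ∂μ = μ.real A * (t * t) + (-2 * ∫ x in A, |ψ x| ∂μ) * t
        + ∫ x in A, ψ x ^ 2 ∂μ := by
      have h1 : ∀ x, (|ψ x| - t) ^ 2 = (ψ x ^ 2 - (2 * t) * |ψ x|) + t * t := by
        intro x; rw [← sq_abs (ψ x)]; ring
      simp_rw [h1]
      have hdiff : Integrable (fun x => ψ x ^ 2 - (2 * t) * |ψ x|) (μ.restrict A) :=
        hsq.sub (habs.const_mul _)
      rw [integral_add hdiff (integrable_const _), integral_sub hsq (habs.const_mul _),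
        integral_const_mul, integral_const]
      simp only [measureReal_restrict_apply_univ, smul_eq_mul]
      ring
    rw [← h]
    exact integral_nonneg fun x => sq_nonneg _
  have := discrim_le_zero key
  rw [discrim] at this
  linarith

/-- If the part of `w * γ` with `|γ| ≤ c` has small second moment and `|γ| > c` is unlikely, then
the first moment of `w * γ` is much smaller than its second moment. -/
lemma sq_integral_abs_le_of_flat_of_spiky {Ω : Type*} [MeasurableSpace Ω] {μ : Measure Ω}
    [IsProbabilityMeasure μ] {w γ : Ω → ℝ} (hγ : Measurable γ)
    (hwγ : MemLp (fun x => w x * γ x) 2 μ) {c ε δ : ℝ}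
    (hspiky : μ.real {x | c < |γ x|} ≤ ε)
    (hflat : ∫ x, w x ^ 2 * (if |γ x| ≤ c then γ x else 0) ^ 2 ∂μ ≤
      δ * ∫ x, w x ^ 2 * γ x ^ 2 ∂μ) :
    (∫ x, |w x * γ x| ∂μ) ^ 2 ≤ 2 * (ε + δ) * ∫ x, w x ^ 2 * γ x ^ 2 ∂μ := by
  set A : Set Ω := {x | c < |γ x|} with hA_def
  have hA : MeasurableSet A := measurableSet_lt measurable_const hγ.abs
  have hmul : ∀ x, (w x * γ x) ^ 2 = w x ^ 2 * γ x ^ 2 := fun x => mul_pow _ _ _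
  have hint : Integrable (fun x => w x ^ 2 * γ x ^ 2) μ := by
    simpa only [hmul] using hwγ.integrable_sq
  have h1 := setIntegral_abs_sq_le hwγ A
  have h2 := setIntegral_abs_sq_le hwγ Aᶜ
  have hsplit := integral_add_compl hA (hwγ.integrable one_le_two).abs
  have hcompl : ∫ x in Aᶜ, (w x * γ x) ^ 2 ∂μ =
      ∫ x, w x ^ 2 * (if |γ x| ≤ c then γ x else 0) ^ 2 ∂μ := by
    rw [← integral_indicator hA.compl]
    refine integral_congr_ae (.of_forall fun x => ?_)
    by_cases hx : |γ x| ≤ c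
    · have : x ∈ Aᶜ := by simpa [hA_def] using hx
      simp [this, hx, mul_pow]
    · have : x ∉ Aᶜ := by simpa [hA_def] using hx
      rw [Set.indicator_of_notMem this]
      simp [hx]
  have hsub : ∫ x in A, (w x * γ x) ^ 2 ∂μ ≤ ∫ x, w x ^ 2 * γ x ^ 2 ∂μ := by
    simp_rw [hmul]
    exact setIntegral_le_integral hint (.of_forall fun x => by positivity)
  set J := ∫ x, w x ^ 2 * γ x ^ 2 ∂μ with hJ
  have hJ0 : 0 ≤ J := integral_nonneg fun x => by positivity
  have hI1 : (∫ x in A, |w x * γ x| ∂μ) ^ 2 ≤ ε * J :=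
    h1.trans (mul_le_mul hspiky hsub (integral_nonneg fun x => sq_nonneg _)
      (measureReal_nonneg.trans hspiky))
  have hI2 : (∫ x in Aᶜ, |w x * γ x| ∂μ) ^ 2 ≤ δ * J := by
    refine h2.trans ((mul_le_of_le_one_left (integral_nonneg fun x => sq_nonneg _)
      measureReal_le_one).trans ?_)
    rw [hcompl]; exact hflat
  rw [← hsplit]
  nlinarith [sq_nonneg ((∫ x in A, |w x * γ x| ∂μ) - ∫ x in Aᶜ, |w x * γ x| ∂μ)]

section Seminorm

variable {E : Type*} [NormedAddCommGroup E] [NormedSpace ℝ E] [MeasurableSpace E] [BorelSpace E]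
  [SecondCountableTopology E] [CompleteSpace E] {μ : Measure E} [IsGaussian μ]

lemma Seminorm.integrable_rpow_of_isGaussian (q : Seminorm ℝ E) (hq : Continuous q)
    {r : ℝ} (hr : 0 ≤ r) : Integrable (fun x => q x ^ r) μ := by
  obtain ⟨C, hC, hb⟩ := q.bound_of_continuous_normedSpace hq
  have hid := (IsGaussian.memLp_id μ (ENNReal.ofReal r) ENNReal.ofReal_ne_top).integrable_norm_rpow'
  rw [ENNReal.toReal_ofReal hr] at hid
  refine (hid.const_mul (C ^ r)).mono' (hq.measurable.pow_const r).aestronglyMeasurable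
    (.of_forall fun x => ?_)
  rw [Real.norm_of_nonneg (Real.rpow_nonneg (apply_nonneg q x) r),
    ← Real.mul_rpow hC.le (norm_nonneg _)]
  exact Real.rpow_le_rpow (apply_nonneg q x) (hb x) hr

lemma Seminorm.memLp_two_of_isGaussian (q : Seminorm ℝ E) (hq : Continuous q) : MemLp q 2 μ := by
  rw [memLp_two_iff_integrable_sq hq.measurable.aestronglyMeasurable]
  simpa using q.integrable_rpow_of_isGaussian hq (μ := μ) (r := 2) zero_le_two

/-- Comparison of the first two moments of a seminorm of a centered Gaussian vector. -/
lemma Seminorm.integral_sq_le_two_mul_sq_integral (q : Seminorm ℝ E) (hq : Continuous q)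
    (hμ : μ[id] = 0) : ∫ x, q x ^ 2 ∂μ ≤ 2 * (∫ x, q x ∂μ) ^ 2 := by
  have h2 : MemLp q 2 μ := q.memLp_two_of_isGaussian hq
  have hi : Integrable q μ := h2.integrable one_le_two
  have hsq : Integrable (fun x => q x ^ 2) μ := h2.integrable_sq
  have hprod : Integrable (fun z : E × E => q z.1 * q z.2) (μ.prod μ) := hi.mul_prod hi
  have hrot := IsGaussian.map_rotation_eq_self hμ (Real.pi / 4)
  have hmeas : AEMeasurable (ContinuousLinearMap.rotation (E := E) (Real.pi / 4)) (μ.prod μ) := by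
    fun_prop
  have hprod' : Integrable
      ((fun z : E × E => q z.1 * q z.2) ∘ ContinuousLinearMap.rotation (Real.pi / 4))
      (μ.prod μ) :=
    Integrable.comp_aemeasurable (by rwa [hrot]) hmeas
  have hM : ∫ z, q z.1 * q z.2 ∂(μ.prod μ) = (∫ x, q x ∂μ) ^ 2 := by
    rw [integral_prod_mul (fun x => q x) (fun x => q x), sq]
  have hM' : ∫ z, ((fun z : E × E => q z.1 * q z.2) ∘
      ContinuousLinearMap.rotation (Real.pi / 4)) z ∂(μ.prod μ) = (∫ x, q x ∂μ) ^ 2 := by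
    rw [← hM]
    conv_rhs => rw [← hrot]
    rw [integral_map hmeas (by rw [hrot]; exact hprod.aestronglyMeasurable)]
    rfl
  have hf1 : Integrable (fun z : E × E => q z.1 ^ 2) (μ.prod μ) := hsq.comp_fst μ
  have hf2 : Integrable (fun z : E × E => q z.2 ^ 2) (μ.prod μ) := hsq.comp_snd μ
  have hhalf : Integrable (fun z : E × E => 1 / 2 * (q z.1 ^ 2 + q z.2 ^ 2)) (μ.prod μ) :=
    (hf1.add hf2).const_mul _
  have hleft : ∫ z, (1 / 2 * (q z.1 ^ 2 + q z.2 ^ 2) - q z.1 * q z.2) ∂(μ.prod μ) =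
      (∫ x, q x ^ 2 ∂μ) - (∫ x, q x ∂μ) ^ 2 := by
    rw [integral_sub hhalf hprod, hM, integral_const_mul,
      integral_add hf1 hf2, integral_fun_fst (fun x => q x ^ 2),
      integral_fun_snd (fun x => q x ^ 2)]
    simp
    ring
  have hle := integral_mono (hhalf.sub hprod) hprod' (fun z => by
    obtain ⟨x, y⟩ := z
    simp only [Pi.sub_apply, Function.comp, ContinuousLinearMap.rotation_apply,
      Real.cos_pi_div_four, Real.sin_pi_div_four]
    have e1 : (√2 / 2) • x + (√2 / 2) • y = (√2 / 2) • (x + y) := by module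
    have e2 : -(√2 / 2) • x + (√2 / 2) • y = (√2 / 2) • (y - x) := by module
    rw [e1, e2, map_smul_eq_mul, map_smul_eq_mul, Real.norm_of_nonneg (by positivity)]
    have a1 : |q x - q y| ≤ q (x + y) := by
      simpa using abs_sub_map_le_sub q x (-y)
    have a2 : |q x - q y| ≤ q (y - x) := by
      rw [abs_sub_comm]; exact abs_sub_map_le_sub q y x
    have a3 := mul_le_mul a1 a2 (abs_nonneg _) (apply_nonneg q _)
    rw [abs_mul_abs_self] at a3
    have a4 : √2 * √2 = 2 := Real.mul_self_sqrt zero_le_two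
    calc _ = 1 / 2 * ((q x - q y) * (q x - q y)) := by ring
      _ ≤ 1 / 2 * (q (x + y) * q (y - x)) := by gcongr
      _ = √2 / 2 * q (x + y) * (√2 / 2 * q (y - x)) := by
        linear_combination (-1 / 4 * (q (x + y) * q (y - x))) * a4)
  rw [hM'] at hle
  have : ∫ z, (1 / 2 * (q z.1 ^ 2 + q z.2 ^ 2) - q z.1 * q z.2) ∂(μ.prod μ) ≤
    (∫ x, q x ∂μ) ^ 2 := hle
  linarith

end Seminorm

lemma stdGaussian_eq (n : ℕ) : _root_.stdGaussian n = ProbabilityTheory.stdGaussian (Euc n) :=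
  map_pi_eq_stdGaussian

instance (n : ℕ) : IsGaussian (_root_.stdGaussian n) := by
  rw [stdGaussian_eq]; infer_instance

lemma integral_id_stdGaussian_eq_zero (n : ℕ) : (_root_.stdGaussian n)[id] = 0 := by
  rw [stdGaussian_eq]; exact integral_id_stdGaussian

lemma gaussianReal_abs_lt_le (s : ℝ) :
    gaussianReal 0 1 {x | |x| < s} ≤ ENNReal.ofReal s := by
  have hset : {x : ℝ | |x| < s} = Set.Ioo (-s) s := by ext; simp [abs_lt]
  rw [hset, gaussianReal_apply 0 one_ne_zero]
  have hpdf : ∀ x, gaussianPDF 0 1 x ≤ ENNReal.ofReal (1 / 2) := by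
    intro x
    refine ENNReal.ofReal_le_ofReal ?_
    rw [gaussianPDFReal]
    have h2 : 2 ≤ √(2 * π * ((1 : NNReal) : ℝ)) := by
      apply Real.le_sqrt_of_sq_le
      norm_num
      linarith [Real.pi_gt_three]
    have h1 : (√(2 * π * ((1 : NNReal) : ℝ)))⁻¹ ≤ 1 / 2 := by
      rw [one_div]; exact inv_anti₀ two_pos h2
    have h3 : rexp (-(x - 0) ^ 2 / (2 * ((1 : NNReal) : ℝ))) ≤ 1 := by
      apply Real.exp_le_one_iff.2
      norm_num
      nlinarith [sq_nonneg x]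
    calc _ ≤ (1 / 2 : ℝ) * 1 := mul_le_mul h1 h3 (Real.exp_nonneg _) (by norm_num)
      _ = 1 / 2 := mul_one _
  calc ∫⁻ x in Set.Ioo (-s) s, gaussianPDF 0 1 x
      ≤ ∫⁻ _ in Set.Ioo (-s) s, ENNReal.ofReal (1 / 2) := lintegral_mono hpdf
    _ = ENNReal.ofReal s := by
      rw [setLIntegral_const, Real.volume_Ioo, ← ENNReal.ofReal_mul (by norm_num)]
      congr 1; ring

lemma stdGaussian_abs_coord_lt_le {n : ℕ} (i : Fin n) {s : ℝ} (hs : 0 ≤ s) :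
    (_root_.stdGaussian n).real {x | |x i| < s} ≤ s := by
  have hlaw : (_root_.stdGaussian n).map (fun x => x i) = gaussianReal 0 1 := by
    rw [_root_.stdGaussian, Measure.map_map (by fun_prop) (by fun_prop)]
    exact (measurePreserving_eval (fun _ : Fin n => gaussianReal 0 1) i).map_eq
  have hpre : {x : Euc n | |x i| < s} = (fun x : Euc n => x i) ⁻¹' {y | |y| < s} := rfl
  refine ENNReal.toReal_le_of_le_ofReal hs ?_
  rw [hpre, ← Measure.map_apply (by fun_prop) (measurableSet_lt (by fun_prop) (by fun_prop)), hlaw]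
  exact gaussianReal_abs_lt_le s

lemma ae_ne_zero_stdGaussian {n : ℕ} (i : Fin n) : ∀ᵐ x ∂_root_.stdGaussian n, x ≠ 0 := by
  have hle : (_root_.stdGaussian n).real {x | ¬ x ≠ 0} ≤ 0 := by
    refine le_of_forall_pos_le_add fun s hs => ?_
    rw [zero_add]
    refine (measureReal_mono ?_).trans (stdGaussian_abs_coord_lt_le i hs.le)
    intro x hx
    have : x = 0 := not_not.1 hx
    simpa [this] using hs
  rw [ae_iff]
  exact (measureReal_eq_zero_iff (by finiteness)).1 (le_antisymm hle measureReal_nonneg)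

section Unconditional

variable {n : ℕ} {q : Seminorm ℝ (Euc n)} {g : Euc n → Euc n} {i : Fin n}

/-- The linear map that multiplies the `i`-th coordinate by `1 - t`. -/
def coordContract (i : Fin n) (t : ℝ) : Euc n →ₗ[ℝ] Euc n :=
  LinearMap.id - t • LinearMap.smulRight (EuclideanSpace.projₗ (𝕜 := ℝ) i)
    (EuclideanSpace.single i (1 : ℝ))

lemma coordContract_apply (i : Fin n) (t : ℝ) (x : Euc n) :
    coordContract i t x = x - t • x i • EuclideanSpace.single i (1 : ℝ) := by
  simp [coordContract]

lemma det_coordContract (i : Fin n) (t : ℝ) : LinearMap.det (coordContract i t) = 1 - t := by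
  have h : LinearMap.toMatrix (EuclideanSpace.basisFun (Fin n) ℝ).toBasis
      (EuclideanSpace.basisFun (Fin n) ℝ).toBasis (coordContract i t) =
      Matrix.diagonal (fun j => if j = i then 1 - t else 1) := by
    ext j k
    rw [LinearMap.toMatrix_apply]
    simp only [OrthonormalBasis.coe_toBasis, OrthonormalBasis.coe_toBasis_repr_apply,
      EuclideanSpace.basisFun_apply, EuclideanSpace.basisFun_repr, coordContract_apply,
      Matrix.diagonal_apply]
    by_cases hjk : j = k <;> by_cases hji : j = i <;> by_cases hki : k = i <;>
      simp_all [eq_comm]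
  rw [← LinearMap.det_toMatrix (EuclideanSpace.basisFun (Fin n) ℝ).toBasis, h,
    Matrix.det_diagonal, Finset.prod_ite_eq' Finset.univ i]
  simp

lemma seminorm_coordContract_le (hrefl : ∀ x, q (coordContract i 2 x) = q x) {t : ℝ}
    (ht0 : 0 ≤ t) (ht1 : t ≤ 1) (x : Euc n) : q (coordContract i t x) ≤ q x := by
  have h : coordContract i t x = (1 - t / 2) • x + (t / 2) • coordContract i 2 x := by
    simp only [coordContract_apply]; module
  rw [h]
  refine (map_add_le_add q _ _).trans_eq ?_
  rw [map_smul_eq_mul, map_smul_eq_mul, hrefl, Real.norm_of_nonneg (by linarith),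
    Real.norm_of_nonneg (by linarith)]
  ring

lemma abs_coord_mul_seminorm_single_le (hrefl : ∀ x, q (coordContract i 2 x) = q x)
    (x : Euc n) : |x i| * q (EuclideanSpace.single i 1) ≤ q x := by
  have h : x i • EuclideanSpace.single i (1 : ℝ) =
      (1 / 2 : ℝ) • (x - coordContract i 2 x) := by
    simp only [coordContract_apply]; module
  rw [← Real.norm_eq_abs, ← map_smul_eq_mul, h, map_smul_eq_mul]
  have := map_sub_le_add q x (coordContract i 2 x)
  rw [hrefl] at this
  norm_num
  linarith

lemma sub_seminorm_coordContract_le (hrefl : ∀ x, q (coordContract i 2 x) = q x) {t : ℝ}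
    (ht0 : 0 ≤ t) (x : Euc n) : q x - q (coordContract i t x) ≤ t * q x := by
  have h := (le_abs_self _).trans (abs_sub_map_le_sub q x (coordContract i t x))
  rw [coordContract_apply, sub_sub_cancel, map_smul_eq_mul, map_smul_eq_mul,
    Real.norm_of_nonneg ht0, Real.norm_eq_abs] at h
  rw [coordContract_apply]
  exact h.trans (mul_le_mul_of_nonneg_left (abs_coord_mul_seminorm_single_le hrefl x) ht0)

lemma hasDerivAt_of_hasGradientAt {f : Euc n → ℝ} {v x : Euc n} (h : HasGradientAt f v x)
    (y : Euc n) : HasDerivAt (fun t : ℝ => f (x + t • y)) ⟪v, y⟫ 0 := by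
  have h1 : HasDerivAt (fun t : ℝ => x + t • y) y 0 := by
    simpa using ((hasDerivAt_id (0 : ℝ)).smul_const y).const_add x
  have h2 : HasFDerivAt f (InnerProductSpace.toDual ℝ (Euc n) v) (x + (0 : ℝ) • y) := by
    simpa using h.hasFDerivAt
  have h3 := h2.comp_hasDerivAt 0 h1
  rwa [InnerProductSpace.toDual_apply_apply] at h3

lemma abs_gradient_coord_le {x : Euc n} (h : HasGradientAt q (g x) x) :
    |g x i| ≤ q (EuclideanSpace.single i 1) := by
  have hd := hasDerivAt_of_hasGradientAt h (EuclideanSpace.single i (1 : ℝ))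
  have hin : ⟪g x, EuclideanSpace.single i (1 : ℝ)⟫ = g x i := by
    simp [EuclideanSpace.inner_single_right]
  rw [hin] at hd
  rw [← Real.norm_eq_abs]
  refine hd.le_of_lip' (apply_nonneg q _) (.of_forall fun t => ?_)
  have := abs_sub_map_le_sub q (x + t • EuclideanSpace.single i (1 : ℝ))
    (x + (0 : ℝ) • EuclideanSpace.single i (1 : ℝ))
  rw [Real.norm_eq_abs]
  refine this.trans_eq ?_
  rw [add_sub_add_left_eq_sub, ← sub_smul, map_smul_eq_mul, mul_comm]

lemma tendsto_slope_sq_coordContract (hd : ∀ x ≠ 0, HasGradientAt q (g x) x) (x : Euc n)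
    {u : ℕ → ℝ} (hu0 : ∀ k, u k ≠ 0) (hu : Filter.Tendsto u Filter.atTop (nhds 0)) :
    Filter.Tendsto (fun k => (u k)⁻¹ * (q x ^ 2 - q (coordContract i (u k) x) ^ 2)) Filter.atTop
      (nhds (2 * (q x * g x i * x i))) := by
  rcases eq_or_ne x 0 with rfl | hx
  · simp
  have h := (hasDerivAt_of_hasGradientAt (hd x hx)
    (-(x i • EuclideanSpace.single i (1 : ℝ)))).pow 2
  have hs := (h.tendsto_slope_zero).comp
    (tendsto_nhdsWithin_iff.2 ⟨hu, .of_forall fun k => hu0 k⟩)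
  have hs' := hs.neg
  convert hs' using 2 with k
  · simp [coordContract_apply, sub_eq_add_neg]
    ring
  · simp [EuclideanSpace.inner_single_right, inner_neg_right, inner_smul_right]
    ring

/-- In the `ℓ`-position, contracting one coordinate does not decrease the second moment of the
norm by more than the volume allows. -/
lemma one_sub_le_integral_sq_coordContract [NeZero n]
    (hell : ∀ U : Euc n →ₗ[ℝ] Euc n,
      (∫ x, q (U x) ^ 2 ∂_root_.stdGaussian n) ≤ 1 → |LinearMap.det U| ≤ 1)
    {t : ℝ} (ht0 : 0 < t) (ht : t < 1 / 2) :
    1 - 4 * t / n ≤ ∫ x, q (coordContract i t x) ^ 2 ∂_root_.stdGaussian n := by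
  have hn : (0 : ℝ) < n := by exact_mod_cast Nat.pos_of_neZero n
  set a : ℝ := 2 * t / n with ha_def
  have ha : 0 < a := by positivity
  have hdet : 1 < |LinearMap.det ((1 + a) • coordContract i t)| := by
    rw [LinearMap.det_smul, det_coordContract, finrank_euclideanSpace_fin]
    have hb := one_add_mul_le_pow (show (-2 : ℝ) ≤ a by linarith) n
    have hna : n * a = 2 * t := by rw [ha_def]; field_simp
    rw [hna] at hb
    refine lt_of_lt_of_le ?_ (le_abs_self _)
    nlinarith
  have hlt : 1 < ∫ x, q (((1 + a) • coordContract i t) x) ^ 2 ∂_root_.stdGaussian n := by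
    by_contra hcon
    exact absurd (hell _ (not_lt.1 hcon)) (not_le.2 hdet)
  have hsm : ∀ x, q (((1 + a) • coordContract i t) x) ^ 2 =
      (1 + a) ^ 2 * q (coordContract i t x) ^ 2 := by
    intro x
    rw [LinearMap.smul_apply, map_smul_eq_mul, Real.norm_of_nonneg (by linarith), mul_pow]
  simp_rw [hsm] at hlt
  rw [integral_const_mul] at hlt
  have h4 : 4 * t / n = 2 * a := by rw [ha_def]; ring
  rw [h4]
  by_contra hcon
  have hcon' := not_le.1 hcon
  have h0 : (1 + a) ^ 2 * ∫ x, q (coordContract i t x) ^ 2 ∂_root_.stdGaussian n ≤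
      (1 + a) ^ 2 * (1 - 2 * a) := by gcongr
  nlinarith [pow_pos ha 2, pow_pos ha 3]

/-- In the `ℓ`-position, each coordinate carries at most a `2 / n` share of
`E ‖G‖ ⟨grad(G), G⟩ = 1`. -/
lemma integral_mul_gradient_coord_le [NeZero n] (hq : Continuous q)
    (hrefl : ∀ x, q (coordContract i 2 x) = q x)
    (hd : ∀ x ≠ 0, HasGradientAt q (g x) x)
    (hone : (∫ x, q x ^ 2 ∂_root_.stdGaussian n) = 1)
    (hell : ∀ U : Euc n →ₗ[ℝ] Euc n,
      (∫ x, q (U x) ^ 2 ∂_root_.stdGaussian n) ≤ 1 → |LinearMap.det U| ≤ 1) :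
    (∀ x, 0 ≤ q x * g x i * x i) ∧
    Integrable (fun x => q x * g x i * x i) (_root_.stdGaussian n) ∧
    ∫ x, q x * g x i * x i ∂_root_.stdGaussian n ≤ 2 / n := by
  set u : ℕ → ℝ := fun k => 1 / ((k : ℝ) + 3) with hu_def
  have hupos : ∀ k, 0 < u k := fun k => by positivity
  have hult : ∀ k, u k < 1 / 2 := fun k => by
    simp only [hu_def]
    exact one_div_lt_one_div_of_lt two_pos (by have : (0 : ℝ) ≤ k := k.cast_nonneg; linarith)
  have hu : Filter.Tendsto u Filter.atTop (nhds 0) := by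
    have h := (tendsto_const_div_atTop_nhds_zero_nat (1 : ℝ)).comp (Filter.tendsto_add_atTop_nat 3)
    refine h.congr fun k => ?_
    simp [hu_def]
  set F : ℕ → Euc n → ℝ := fun k x => (u k)⁻¹ * (q x ^ 2 - q (coordContract i (u k) x) ^ 2)
    with hF_def
  have hlim : ∀ x, Filter.Tendsto (fun k => F k x) Filter.atTop (nhds (2 * (q x * g x i * x i))) :=
    fun x => tendsto_slope_sq_coordContract hd x (fun k => (hupos k).ne') hu
  have hF0 : ∀ k x, 0 ≤ F k x := by
    intro k x
    have h := seminorm_coordContract_le hrefl (hupos k).le ((hult k).le.trans (by norm_num)) x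
    exact mul_nonneg (inv_nonneg.2 (hupos k).le)
      (sub_nonneg.2 (pow_le_pow_left₀ (apply_nonneg q _) h 2))
  have hF2 : ∀ k x, F k x ≤ 2 * q x ^ 2 := by
    intro k x
    have h := seminorm_coordContract_le hrefl (hupos k).le ((hult k).le.trans (by norm_num)) x
    have h' := sub_seminorm_coordContract_le hrefl (hupos k).le x
    rw [hF_def]
    simp only
    rw [inv_mul_le_iff₀ (hupos k)]
    nlinarith [apply_nonneg q x, apply_nonneg q (coordContract i (u k) x)]
  have hsq : Integrable (fun x => q x ^ 2) (_root_.stdGaussian n) :=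
    (q.memLp_two_of_isGaussian hq).integrable_sq
  have hqc : ∀ t, Continuous fun x => q (coordContract i t x) := fun t =>
    hq.comp (coordContract i t).continuous_of_finiteDimensional
  have hFmeas : ∀ k, Continuous (F k) := fun k =>
    continuous_const.mul ((hq.pow 2).sub ((hqc _).pow 2))
  have hD0 : ∀ x, 0 ≤ q x * g x i * x i := fun x => by
    have := ge_of_tendsto' (hlim x) fun k => hF0 k x
    linarith
  have hD2 : ∀ x, q x * g x i * x i ≤ q x ^ 2 := fun x => by
    have := le_of_tendsto' (hlim x) fun k => hF2 k x
    linarith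
  have hDmeas : AEStronglyMeasurable (fun x => 2 * (q x * g x i * x i)) (_root_.stdGaussian n) :=
    aestronglyMeasurable_of_tendsto_ae _ (fun k => (hFmeas k).aestronglyMeasurable)
      (.of_forall hlim)
  have hDint2 : Integrable (fun x => 2 * (q x * g x i * x i)) (_root_.stdGaussian n) :=
    (hsq.const_mul 2).mono' hDmeas (.of_forall fun x => by
      rw [Real.norm_of_nonneg (by linarith [hD0 x])]
      linarith [hD2 x])
  have hDint : Integrable (fun x => q x * g x i * x i) (_root_.stdGaussian n) := by
    simpa using hDint2.const_mul (1 / 2)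
  refine ⟨hD0, hDint, ?_⟩
  have hcv := tendsto_integral_of_dominated_convergence (fun x => 2 * q x ^ 2)
    (fun k => (hFmeas k).aestronglyMeasurable) (hsq.const_mul 2)
    (fun k => .of_forall fun x => by rw [Real.norm_of_nonneg (hF0 k x)]; exact hF2 k x)
    (.of_forall hlim : ∀ᵐ x ∂_root_.stdGaussian n, _)
  have hbound : ∀ k, ∫ x, F k x ∂_root_.stdGaussian n ≤ 4 / n := by
    intro k
    have hsqU : Integrable (fun x => q (coordContract i (u k) x) ^ 2) (_root_.stdGaussian n) :=
      hsq.mono' ((hqc _).pow 2).aestronglyMeasurable (.of_forall fun x => by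
        rw [Real.norm_of_nonneg (sq_nonneg _)]
        exact pow_le_pow_left₀ (apply_nonneg q _) (seminorm_coordContract_le hrefl (hupos k).le
          ((hult k).le.trans (by norm_num)) x) 2)
    rw [integral_const_mul, integral_sub hsq hsqU, hone, inv_mul_le_iff₀ (hupos k)]
    have := one_sub_le_integral_sq_coordContract (i := i) hell (hupos k) (hult k)
    have e : u k * (4 / n) = 4 * u k / n := by ring
    rw [e]
    linarith
  have := le_of_tendsto' hcv hbound
  rw [integral_const_mul] at this
  have e : (4 : ℝ) / n = 2 * (2 / n) := by ring
  linarith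

/-- In the `ℓ`-position, a coordinate of the gradient is rarely large. -/
lemma measureReal_lt_abs_gradient_coord_le [NeZero n] (hq : Continuous q)
    (hrefl : ∀ x, q (coordContract i 2 x) = q x)
    (hd : ∀ x ≠ 0, HasGradientAt q (g x) x)
    (hone : (∫ x, q x ^ 2 ∂_root_.stdGaussian n) = 1)
    (hell : ∀ U : Euc n →ₗ[ℝ] Euc n,
      (∫ x, q (U x) ^ 2 ∂_root_.stdGaussian n) ≤ 1 → |LinearMap.det U| ≤ 1)
    {c s : ℝ} (hc : 0 < c) (hs : 0 < s) :
    (_root_.stdGaussian n).real {x | c < |g x i|} ≤ s + 2 / (n * (c * s) ^ 2) := by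
  obtain ⟨hD0, hDint, hD⟩ := integral_mul_gradient_coord_le hq hrefl hd hone hell
  have hmarkov := mul_meas_ge_le_integral_of_nonneg (.of_forall hD0) hDint ((c * s) ^ 2)
  have hcs : 0 < (c * s) ^ 2 := by positivity
  have hn : (0 : ℝ) < n := by exact_mod_cast Nat.pos_of_neZero n
  have hmarkov' : (_root_.stdGaussian n).real {x | (c * s) ^ 2 ≤ q x * g x i * x i} ≤
      2 / (n * (c * s) ^ 2) := by
    rw [← div_div, le_div_iff₀ hcs, mul_comm]
    exact hmarkov.trans hD
  have hsub : {x | c < |g x i|} ⊆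
      {x : Euc n | |x i| < s} ∪ {x | (c * s) ^ 2 ≤ q x * g x i * x i} := by
    intro x hx
    by_cases hxs : |x i| < s
    · exact Or.inl hxs
    refine Or.inr ?_
    have hxs' := not_lt.1 hxs
    have hx0 : x ≠ 0 := by
      rintro rfl
      simp at hxs'
      linarith
    have h1 : c ≤ q (EuclideanSpace.single i 1) :=
      (le_of_lt hx).trans (abs_gradient_coord_le (hd x hx0))
    have h2 : s * c ≤ q x := (mul_le_mul hxs' h1 hc.le (abs_nonneg _)).trans
      (abs_coord_mul_seminorm_single_le hrefl x)
    change (c * s) ^ 2 ≤ q x * g x i * x i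
    calc (c * s) ^ 2 = (s * c) * c * s := by ring
      _ ≤ q x * |g x i| * |x i| := by
        have hx' : c ≤ |g x i| := le_of_lt hx
        gcongr
      _ = |q x * g x i * x i| := by
        rw [abs_mul, abs_mul, abs_of_nonneg (apply_nonneg q x)]
      _ = q x * g x i * x i := abs_of_nonneg (hD0 x)
  calc _ ≤ _ := measureReal_mono hsub
    _ ≤ _ := measureReal_union_le _ _
    _ ≤ _ := add_le_add (stdGaussian_abs_coord_lt_le i hs.le) hmarkov'

end Unconditional

lemma rpow_neg_quarter_add_le {x m : ℝ} (hx : 5 ^ 8 ≤ x) (hm : 1 / 2 ≤ m ^ 2) :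
    x ^ (-(1 : ℝ) / 4) + 2 / (x * (x ^ (-(1 : ℝ) / 8) * m * x ^ (-(1 : ℝ) / 4)) ^ 2) ≤
      x ^ (-(1 / 8 : ℝ)) := by
  have hx0 : 0 < x := by linarith [show (0 : ℝ) < 5 ^ 8 by norm_num]
  set b : ℝ := x ^ (-(1 / 8) : ℝ) with hb
  have hb0 : 0 < b := Real.rpow_pos_of_pos hx0 _
  have e8 : x ^ (-(1 : ℝ) / 8) = b := by rw [hb]; congr 1; norm_num
  have e4 : x ^ (-(1 : ℝ) / 4) = b ^ 2 := by
    rw [hb, ← Real.rpow_natCast, ← Real.rpow_mul hx0.le]; norm_num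
  have ex : x * b ^ 8 = 1 := by
    rw [hb, ← Real.rpow_natCast, ← Real.rpow_mul hx0.le]
    norm_num
    rw [Real.rpow_neg_one]
    exact mul_inv_cancel₀ hx0.ne'
  have hb5 : b ≤ 1 / 5 := by
    by_contra hcon
    have h1 : (1 / 5 : ℝ) ^ 8 < b ^ 8 :=
      pow_lt_pow_left₀ (not_le.1 hcon) (by norm_num) (by norm_num)
    have h2 : 5 ^ 8 * (1 / 5 : ℝ) ^ 8 < x * b ^ 8 := mul_lt_mul' hx h1 (by norm_num) hx0
    norm_num [ex] at h2
  rw [e8, e4]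
  have hm0 : 0 < m ^ 2 := by linarith
  have h3 : 2 / (x * (b * m * b ^ 2) ^ 2) = b ^ 2 * (2 / m ^ 2) := by
    have hm' : m ≠ 0 := by rintro rfl; norm_num at hm0
    rw [mul_div_assoc', div_eq_div_iff (by positivity) (by positivity)]
    linear_combination (-(2 * m ^ 2)) * ex
  have h4 : 2 / m ^ 2 ≤ 4 := by rw [div_le_iff₀ hm0]; linarith
  rw [h3]
  nlinarith [mul_le_mul_of_nonneg_left h4 (sq_nonneg b)]

lemma gauge_coordContract_two {n : ℕ} {B : Set (Euc n)} (hB : StdUncond B) (i : Fin n)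
    (x : Euc n) : gauge B (coordContract i 2 x) = gauge B x := by
  have h := hB x (fun j => if j = i then -1 else 1) (fun j => by by_cases hj : j = i <;> simp [hj])
  convert h using 2
  · ext j
    rw [coordContract_apply]
    by_cases hj : j = i
    · subst hj; simp; ring
    · simp [hj]
  · rfl

/-- **The spiky part estimate**: for a smooth origin-symmetric convex body in the
ℓ-position with `1`-unconditional standard basis, if the flat part of the `i`-th
coordinate is dominated as
`E(‖G‖_B^{2p−2}·Fᵢ²(B,G)) ≤ n^{−τ}·E(‖G‖_B^{2p−2}·⟨grad_B(G),eᵢ⟩²)`, then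
`(E|‖G‖_B^{p−1}·⟨grad_B(G),eᵢ⟩|)² ≤ 2(n^{−c'}+n^{−τ})·E(‖G‖_B^{2p−2}·⟨grad_B(G),eᵢ⟩²)`. -/
theorem spiky_part_estimate :
    ∃ (n₀ : ℕ) (c' : ℝ), 0 < c' ∧ ∀ n : ℕ, n₀ ≤ n →
      ∀ B : Set (Euc n), IsSymmConvexBody B → IsEllPosition B → StdUncond B →
      ∀ gradB : Euc n → Euc n,
        (∀ x : Euc n, x ≠ 0 → HasGradientAt (gauge B) (gradB x) x) →
      ∀ i : Fin n, ∀ p : ℝ, 1 ≤ p → ∀ τ : ℝ, 0 < τ →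
        (∫ x, gauge B x ^ (2 * p - 2) * flatPart B gradB i x ^ 2 ∂stdGaussian n) ≤
          (n : ℝ) ^ (-τ) *
            ∫ x, gauge B x ^ (2 * p - 2) * (gradB x i) ^ 2 ∂stdGaussian n →
        (∫ x, |gauge B x ^ (p - 1) * gradB x i| ∂stdGaussian n) ^ 2 ≤
          2 * ((n : ℝ) ^ (-c') + (n : ℝ) ^ (-τ)) *
            ∫ x, gauge B x ^ (2 * p - 2) * (gradB x i) ^ 2 ∂stdGaussian n := by
  refine ⟨5 ^ 8, 1 / 8, by norm_num, fun n hn B hB hell huncond gradB hgrad i p hp τ _ hflat => ?_⟩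
  obtain ⟨-, hconv, hint, hsymm⟩ := hB
  have : NeZero n := ⟨by rintro rfl; norm_num at hn⟩
  have hnhds : B ∈ nhds (0 : Euc n) := mem_interior_iff_mem_nhds.1 hint
  let q : Seminorm ℝ (Euc n) := gaugeSeminorm ((balanced_iff_neg_mem hconv).2 fun x => hsymm x)
    hconv (absorbent_nhds_zero hnhds)
  have hq : Continuous q := continuous_gauge hconv hnhds
  have hx0 := ae_ne_zero_stdGaussian i
  set M : ℝ := ∫ y, gauge B y ∂_root_.stdGaussian n with hM_def
  have hM : 1 / 2 ≤ M ^ 2 := by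
    have h := q.integral_sq_le_two_mul_sq_integral hq (integral_id_stdGaussian_eq_zero n)
    have h1 : (∫ x, q x ^ 2 ∂_root_.stdGaussian n) = 1 := hell.1
    have h2 : (∫ x, q x ∂_root_.stdGaussian n) = M := rfl
    rw [h1, h2] at h
    linarith
  have hM0 : 0 < M := by
    have : 0 ≤ M := integral_nonneg fun x => gauge_nonneg x
    exact this.lt_of_ne' (by intro h0; norm_num [h0] at hM)
  have hnR : (5 : ℝ) ^ 8 ≤ n := by exact_mod_cast hn
  have hn0 : (0 : ℝ) < n := by exact_mod_cast Nat.pos_of_neZero n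
  set c : ℝ := (n : ℝ) ^ (-(1 : ℝ) / 8) * M with hc_def
  have hc : 0 < c := mul_pos (Real.rpow_pos_of_pos hn0 _) hM0
  have hspiky : (_root_.stdGaussian n).real {x | c < |gradB x i|} ≤ (n : ℝ) ^ (-(1 / 8 : ℝ)) :=
    (measureReal_lt_abs_gradient_coord_le (q := q) hq (gauge_coordContract_two huncond i) hgrad
      hell.1 hell.2 hc (Real.rpow_pos_of_pos hn0 (-(1 : ℝ) / 4))).trans
      (rpow_neg_quarter_add_le hnR hM)
  let γ : Euc n → ℝ := fun x => fderiv ℝ (gauge B) x (EuclideanSpace.single i (1 : ℝ))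
  have hγ : Measurable γ := measurable_fderiv_apply_const ℝ (gauge B) _
  have hγ_eq : ∀ᵐ x ∂_root_.stdGaussian n, gradB x i = γ x := by
    filter_upwards [hx0] with x hx
    simp [γ, (hgrad x hx).hasFDerivAt.fderiv, EuclideanSpace.inner_single_right]
  have hγ_le : ∀ᵐ x ∂_root_.stdGaussian n, |γ x| ≤ q (EuclideanSpace.single i 1) := by
    filter_upwards [hx0, hγ_eq] with x hx hxγ
    rw [← hxγ]
    exact abs_gradient_coord_le (q := q) (hgrad x hx)
  have hpow : ∀ x, gauge B x ^ (2 * p - 2) = (gauge B x ^ (p - 1)) ^ 2 := fun x => by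
    rw [← Real.rpow_natCast, ← Real.rpow_mul (gauge_nonneg x)]
    congr 1
    push_cast
    ring
  have hmem : MemLp (fun x => gauge B x ^ (p - 1) * γ x) 2 (_root_.stdGaussian n) := by
    have hmeas : Measurable fun x => gauge B x ^ (p - 1) * γ x :=
      (hq.measurable.pow_const (p - 1)).mul hγ
    rw [memLp_two_iff_integrable_sq hmeas.aestronglyMeasurable]
    have hi : Integrable (fun x => q x ^ (2 * p - 2)) (_root_.stdGaussian n) :=
      q.integrable_rpow_of_isGaussian hq (by linarith)
    refine (hi.mul_const (q (EuclideanSpace.single i 1) ^ 2)).mono'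
      (hmeas.pow_const 2).aestronglyMeasurable ?_
    filter_upwards [hγ_le] with x hx
    rw [Real.norm_of_nonneg (sq_nonneg _), mul_pow, ← hpow, ← sq_abs (γ x)]
    exact mul_le_mul_of_nonneg_left (pow_le_pow_left₀ (abs_nonneg _) hx 2)
      (Real.rpow_nonneg (gauge_nonneg x) _)
  have hsecond : ∫ x, gauge B x ^ (2 * p - 2) * (gradB x i) ^ 2 ∂_root_.stdGaussian n =
      ∫ x, (gauge B x ^ (p - 1)) ^ 2 * γ x ^ 2 ∂_root_.stdGaussian n :=
    integral_congr_ae (by filter_upwards [hγ_eq] with x hx; rw [hx, hpow])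
  have hfirst : ∫ x, |gauge B x ^ (p - 1) * gradB x i| ∂_root_.stdGaussian n =
      ∫ x, |gauge B x ^ (p - 1) * γ x| ∂_root_.stdGaussian n :=
    integral_congr_ae (by filter_upwards [hγ_eq] with x hx; rw [hx])
  have hflat_eq :
      ∫ x, gauge B x ^ (2 * p - 2) * flatPart B gradB i x ^ 2 ∂_root_.stdGaussian n =
      ∫ x, (gauge B x ^ (p - 1)) ^ 2 * (if |γ x| ≤ c then γ x else 0) ^ 2
        ∂_root_.stdGaussian n :=
    integral_congr_ae (by filter_upwards [hγ_eq] with x hx; rw [flatPart, hx, hpow])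
  have hspiky' : (_root_.stdGaussian n).real {x | c < |γ x|} ≤ (n : ℝ) ^ (-(1 / 8 : ℝ)) := by
    refine le_of_eq_of_le (measureReal_congr ?_) hspiky
    filter_upwards [hγ_eq] with x hx
    exact propext (show c < |γ x| ↔ c < |gradB x i| by rw [hx])
  rw [hsecond, hflat_eq] at hflat
  rw [hsecond, hfirst]
  exact sq_integral_abs_le_of_flat_of_spiky hγ hmem hspiky' hflat
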